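/- Let (Ω, F, P) be a probability space, G ⊆ F a sub-σ-algebra, and Y : Ω → ℝ a random variable independent of G whose law has density f₀ with respect to Lebesgue measure, with f₀ > 0 Lebesgue-almost everywhere. Let Θ be a finite type, let f : Θ → (ℝ → ℝ≥0) assign to each θ ∈ Θ a probability density with respect to Lebesgue measure (∫ f(θ)(y) dy = 1), and let θ̂ : Ω → Θ be G-measurable. Then E[ f(θ̂)(Y) / f₀(Y) ∣ G ] = 1 almost surely. -/

import Mathlib

open MeasureTheory Real ProbabilityTheory

theorem aux_lr {Ω : Type*} {G : MeasurableSpace Ω} {mΩ : MeasurableSpace Ω} (μ : Measure Ω)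
    [IsProbabilityMeasure μ] (hG : G ≤ mΩ)
    (Y : Ω → ℝ) (hY : Measurable Y)
    (hYindep : Indep (MeasurableSpace.comap Y Real.measurableSpace) G μ)
    (f₀ : ℝ → ℝ) (hf₀m : Measurable f₀)
    (hf₀pos : ∀ᵐ y ∂(volume : Measure ℝ), 0 < f₀ y)
    (hYlaw : Measure.map Y μ = volume.withDensity (fun y => ENNReal.ofReal (f₀ y)))
    {Θ : Type*} [Fintype Θ] [MeasurableSpace Θ] [MeasurableSingletonClass Θ]
    (f : Θ → ℝ → ℝ) (hfm : ∀ θ, Measurable (f θ)) (hfnonneg : ∀ θ y, 0 ≤ f θ y)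
    (hfdens : ∀ θ, ∫⁻ y, ENNReal.ofReal (f θ y) ∂(volume : Measure ℝ) = 1)
    (θhat : Ω → Θ) (hθhat : Measurable[G] θhat) :
    μ[fun ω => f (θhat ω) (Y ω) / f₀ (Y ω) | G] =ᵐ[μ] fun _ => (1 : ℝ) := by
  classical
  have hac : Measure.map Y μ ≪ volume := hYlaw ▸ withDensity_absolutelyContinuous _ _
  have hpos : ∀ᵐ ω ∂μ, 0 < f₀ (Y ω) := ae_of_ae_map hY.aemeasurable (hac.ae_le hf₀pos)
  have hqm : ∀ θ, Measurable (fun y => f θ y / f₀ y) := fun θ => (hfm θ).div hf₀m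
  have hnn : ∀ θ, 0 ≤ᵐ[μ] fun ω => f θ (Y ω) / f₀ (Y ω) := fun θ => by
    filter_upwards [hpos] with ω h
    exact div_nonneg (hfnonneg _ _) h.le
  have hlin : ∀ θ, ∫⁻ ω, ENNReal.ofReal (f θ (Y ω) / f₀ (Y ω)) ∂μ = 1 := fun θ => by
    rw [← lintegral_map (f := fun y => ENNReal.ofReal (f θ y / f₀ y)) (hqm θ).ennreal_ofReal hY,
      hYlaw, lintegral_withDensity_eq_lintegral_mul _ hf₀m.ennreal_ofReal (hqm θ).ennreal_ofReal,
      ← hfdens θ]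
    refine lintegral_congr_ae ?_
    filter_upwards [hf₀pos] with y hy
    simp only [Pi.mul_apply]
    rw [← ENNReal.ofReal_mul hy.le, mul_div_cancel₀ _ hy.ne']
  have hint : ∀ θ, Integrable (fun ω => f θ (Y ω) / f₀ (Y ω)) μ := fun θ => by
    refine ⟨((hqm θ).comp hY).aestronglyMeasurable, ?_⟩
    rw [hasFiniteIntegral_iff_ofReal (hnn θ), hlin θ]
    exact ENNReal.one_lt_top
  have hone : ∀ θ, ∫ ω, f θ (Y ω) / f₀ (Y ω) ∂μ = 1 := fun θ => by
    rw [integral_eq_lintegral_of_nonneg_ae (hnn θ) (hint θ).1, hlin θ, ENNReal.toReal_one]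
  have hce : ∀ θ, μ[fun ω => f θ (Y ω) / f₀ (Y ω) | G] =ᵐ[μ] fun _ => (1 : ℝ) := fun θ => by
    have h := condExp_indep_eq (f := fun ω => f θ (Y ω) / f₀ (Y ω)) hY.comap_le hG
      ((hqm θ).comp (comap_measurable Y)).stronglyMeasurable hYindep
    rwa [hone θ] at h
  have hs : ∀ θ, MeasurableSet[G] (θhat ⁻¹' {θ}) := fun θ => hθhat (measurableSet_singleton θ)
  have hsum : (fun ω => f (θhat ω) (Y ω) / f₀ (Y ω))
      = ∑ θ, (θhat ⁻¹' {θ}).indicator (fun ω => f θ (Y ω) / f₀ (Y ω)) := by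
    ext ω
    simp [Finset.sum_apply, Set.indicator_apply]
  rw [hsum]
  refine (condExp_finsetSum (fun θ _ => (hint θ).indicator (hG _ (hs θ))) G).trans ?_
  have hall : ∀ᵐ ω ∂μ, ∀ θ, (μ[(θhat ⁻¹' {θ}).indicator
      (fun ω => f θ (Y ω) / f₀ (Y ω)) | G]) ω = (θhat ⁻¹' {θ}).indicator (fun _ => (1 : ℝ)) ω := by
    rw [ae_all_iff]
    intro θ
    filter_upwards [condExp_indicator (hint θ) (hs θ), hce θ] with ω h1 h2
    rw [h1]
    simp only [Set.indicator_apply, h2]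
  filter_upwards [hall] with ω h
  simp [Finset.sum_apply, h, Set.indicator_apply]

/-- One-step unit conditional expectation of the adaptive likelihood ratio: if `Y` is
independent of the sub-σ-algebra `G`, has density `f₀ > 0` (a.e.) with respect to Lebesgue
measure, each `f θ` is a probability density, and the parameter estimate `θ̂` is
`G`-measurable, then `E[ f(θ̂)(Y) / f₀(Y) ∣ G ] = 1` almost surely. -/
theorem condexp_adaptive_likelihood_ratio
    {Ω : Type*} {mΩ : MeasurableSpace Ω} (μ : Measure Ω) [IsProbabilityMeasure μ]
    (G : MeasurableSpace Ω) (hG : G ≤ mΩ)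
    (Y : Ω → ℝ) (hY : Measurable[mΩ] Y)
    (hYindep : @Indep Ω (MeasurableSpace.comap Y Real.measurableSpace) G mΩ μ)
    (f₀ : ℝ → ℝ) (hf₀m : Measurable f₀)
    (hf₀pos : ∀ᵐ y ∂(volume : Measure ℝ), 0 < f₀ y)
    (hYlaw : @Measure.map Ω ℝ mΩ Real.measurableSpace Y μ
      = volume.withDensity (fun y => ENNReal.ofReal (f₀ y)))
    {Θ : Type*} [Fintype Θ] [MeasurableSpace Θ] [MeasurableSingletonClass Θ]
    (f : Θ → ℝ → ℝ) (hfm : ∀ θ, Measurable (f θ)) (hfnonneg : ∀ θ y, 0 ≤ f θ y)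
    (hfdens : ∀ θ, ∫⁻ y, ENNReal.ofReal (f θ y) ∂(volume : Measure ℝ) = 1)
    (θhat : Ω → Θ) (hθhat : Measurable[G] θhat) :
    μ[fun ω => f (θhat ω) (Y ω) / f₀ (Y ω) | G] =ᵐ[μ] fun _ => (1 : ℝ) := by
  exact aux_lr μ hG Y hY hYindep f₀ hf₀m hf₀pos hYlaw f hfm hfnonneg hfdens θhat hθhat
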